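/- Halin's grid theorem: An infinite graph G has a thick end if and only if G contains a subdivision of the hexagonal quarter grid H^∞. -/

import Mathlib

open SimpleGraph Set

universe u u2

/-- A ray in `G`: an injective one-way infinite path. -/
def IsRay {V : Type u} (G : SimpleGraph V) (f : ℕ → V) : Prop :=
  Function.Injective f ∧ ∀ n, G.Adj (f n) (f (n + 1))

/-- Two rays are equivalent (belong to the same end) iff for every finite vertex set `F`
there are tails of both rays avoiding `F` that are joined by a walk avoiding `F`. -/
def RaysEquiv {V : Type u} (G : SimpleGraph V) (R S : ℕ → V) : Prop :=
  ∀ F : Finset V, ∃ m n,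
    (∀ i, R (m + i) ∉ F) ∧ (∀ i, S (n + i) ∉ F) ∧
    ∃ p : G.Walk (R m) (S n), ∀ x ∈ p.support, x ∉ F

/-- `G` has a thick end: an infinite family of pairwise disjoint, pairwise equivalent rays. -/
def HasThickEnd {V : Type u} (G : SimpleGraph V) : Prop :=
  ∃ R : ℕ → ℕ → V,
    (∀ n, IsRay G (R n)) ∧
    (∀ m n, m ≠ n → Disjoint (Set.range (R m)) (Set.range (R n))) ∧
    (∀ m n, RaysEquiv G (R m) (R n))

/-- The hexagonal quarter grid `H^∞`: rows are horizontal rays, with vertical edges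
between consecutive rows at alternating positions. -/
def hexGrid : SimpleGraph (ℕ × ℕ) :=
  SimpleGraph.fromRel (fun p q =>
    (p.2 = q.2 ∧ q.1 = p.1 + 1) ∨
    (p.1 = q.1 ∧ q.2 = p.2 + 1 ∧ p.1 % 2 = p.2 % 2))

/-- `H` is a topological minor of `G` (`G` contains a subdivision of `H`):
branch vertices are given by an injection, edges by internally disjoint paths. -/
def IsTopMinor {W : Type u} {V : Type u2} (H : SimpleGraph W) (G : SimpleGraph V) : Prop :=
  ∃ f : W → V, Function.Injective f ∧
    ∃ P : ∀ ⦃a b : W⦄, H.Adj a b → G.Walk (f a) (f b),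
      (∀ ⦃a b : W⦄ (h : H.Adj a b), (P h).IsPath) ∧
      (∀ ⦃a b : W⦄ (h : H.Adj a b) (w : W), f w ∈ (P h).support → w = a ∨ w = b) ∧
      (∀ ⦃a b : W⦄ (h : H.Adj a b) ⦃a' b' : W⦄ (h' : H.Adj a' b'),
        s(a, b) ≠ s(a', b') →
        ∀ x, x ∈ (P h).support → x ∈ (P h').support →
          (x = f a ∨ x = f b) ∧ (x = f a' ∨ x = f b'))

/-- An `A–B` path: a path meeting `A` exactly in its first vertex and `B` exactly
in its last vertex. -/
def IsABPath {V : Type u} (G : SimpleGraph V) (A B : Set V) {x y : V} (p : G.Walk x y) : Prop :=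
  p.IsPath ∧ x ∈ A ∧ y ∈ B ∧
    ∀ z ∈ p.support, (z ∈ A → z = x) ∧ (z ∈ B → z = y)

namespace Halin

/-- Indexed greedy choice. -/
lemma exists_seq {α : Type*} (P : ℕ → α → Prop) (r : α → α → Prop)
    (h : ∀ n (s : List α), ∃ y, P n y ∧ ∀ x ∈ s, r x y) :
    ∃ f : ℕ → α, (∀ n, P n (f n)) ∧ ∀ m n, m < n → r (f m) (f n) := by
  choose c hc1 hc2 using h
  let g : ℕ → List α := fun n => Nat.rec [] (fun k l => c k l :: l) n
  have hg : ∀ n, g (n + 1) = c n (g n) :: g n := fun n => rfl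
  have hmem : ∀ m n, m < n → c m (g m) ∈ g n := by
    intro m n hmn
    induction n with
    | zero => omega
    | succ n ih =>
      rw [hg]
      rcases Nat.lt_succ_iff_lt_or_eq.mp hmn with h | h
      · exact List.mem_cons_of_mem _ (ih h)
      · subst h; exact List.mem_cons_self
  exact ⟨fun n => c n (g n), fun n => hc1 _ _, fun m n hmn => hc2 _ _ _ (hmem m n hmn)⟩

variable {V : Type u} {G : SimpleGraph V}

/-- Truncating a walk to an `A`–`B` path. -/
lemma trunc (A B : Set V) {a b : V} (p : G.Walk a b) (ha : a ∈ A) (hb : b ∈ B) :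
    ∃ a' ∈ A, ∃ b' ∈ B, ∃ q : G.Walk a' b', q.IsPath ∧ (∀ x ∈ q.support, x ∈ p.support) ∧
      (∀ x ∈ q.support, x ∈ A → x = a') ∧ (∀ x ∈ q.support, x ∈ B → x = b') := by
  classical
  let Q : ℕ → Prop := fun n => ∃ a' ∈ A, ∃ b' ∈ B, ∃ q : G.Walk a' b',
    (∀ x ∈ q.support, x ∈ p.support) ∧ q.length = n
  have hQ : ∃ n, Q n := ⟨_, a, ha, b, hb, p, fun x h => h, rfl⟩
  obtain ⟨a', ha', b', hb', q, hq, hl⟩ := Nat.find_spec hQ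
  have hmin : ∀ a₂ ∈ A, ∀ b₂ ∈ B, ∀ q' : G.Walk a₂ b₂, (∀ x ∈ q'.support, x ∈ p.support) →
      q.length ≤ q'.length := by
    intro a₂ h1 b₂ h2 q' h3
    rw [hl]
    exact Nat.find_min' hQ ⟨a₂, h1, b₂, h2, q', h3, rfl⟩
  refine ⟨a', ha', b', hb', q.bypass, q.bypass_isPath,
    fun x hx => hq x (q.support_bypass_subset_support hx), ?_, ?_⟩
  · intro x hx hxA
    have hx := q.support_bypass_subset_support hx
    have h1 := hmin x hxA b' hb' (q.dropUntil x hx)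
      (fun z hz => hq z (q.support_dropUntil_subset_support hx hz))
    have h2 := congrArg Walk.length (q.take_spec hx)
    rw [Walk.length_append] at h2
    have h3 : (q.takeUntil x hx).length = 0 := by omega
    exact (Walk.eq_of_length_eq_zero h3).symm
  · intro x hx hxB
    have hx := q.support_bypass_subset_support hx
    have h1 := hmin a' ha' x hxB (q.takeUntil x hx)
      (fun z hz => hq z (q.support_takeUntil_subset_support hx hz))
    have h2 := congrArg Walk.length (q.take_spec hx)
    rw [Walk.length_append] at h2
    have h3 : (q.dropUntil x hx).length = 0 := by omega
    exact (Walk.eq_of_length_eq_zero h3)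

/-- Walking along a ray. -/
lemma ray_seg {f : ℕ → V} (hf : IsRay G f) (i j : ℕ) (hij : i ≤ j) :
    ∃ p : G.Walk (f i) (f j), ∀ x ∈ p.support, ∃ k, i ≤ k ∧ k ≤ j ∧ f k = x := by
  induction j, hij using Nat.le_induction with
  | base => exact ⟨Walk.nil, fun x hx => ⟨i, le_rfl, le_rfl, by simpa [eq_comm] using hx⟩⟩
  | succ j hij ih =>
    obtain ⟨p, hp⟩ := ih
    refine ⟨p.concat (hf.2 j), ?_⟩
    intro x hx
    rw [Walk.support_concat] at hx
    simp only [List.mem_append, List.mem_singleton] at hx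
    rcases hx with hx | hx
    · obtain ⟨k, h1, h2, h3⟩ := hp x hx
      exact ⟨k, h1, by omega, h3⟩
    · exact ⟨j + 1, by omega, le_rfl, hx.symm⟩

lemma ray_seg' {f : ℕ → V} (hf : IsRay G f) (i j : ℕ) :
    ∃ p : G.Walk (f i) (f j), ∀ x ∈ p.support, ∃ k, min i j ≤ k ∧ f k = x := by
  rcases le_total i j with h | h
  · obtain ⟨p, hp⟩ := ray_seg hf i j h
    refine ⟨p, fun x hx => ?_⟩
    obtain ⟨k, h1, h2, h3⟩ := hp x hx
    exact ⟨k, by omega, h3⟩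
  · obtain ⟨p, hp⟩ := ray_seg hf j i h
    refine ⟨p.reverse, fun x hx => ?_⟩
    obtain ⟨k, h1, h2, h3⟩ := hp x (by simpa using hx)
    exact ⟨k, by omega, h3⟩

/-- `A` and `B` cannot be separated by a finite set in `G - Z`. -/
def Lk (G : SimpleGraph V) (A B Z : Set V) : Prop :=
  ∀ F : Finset V, ∃ a ∈ A, ∃ b ∈ B, ∃ p : G.Walk a b, ∀ x ∈ p.support, x ∉ F ∧ x ∉ Z

lemma Lk.symm {A B Z : Set V} (h : Lk G A B Z) : Lk G B A Z := by
  intro F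
  obtain ⟨a, ha, b, hb, p, hp⟩ := h F
  exact ⟨b, hb, a, ha, p.reverse, by simpa using hp⟩

lemma Lk.mono {A A' B B' Z Z' : Set V} (h : Lk G A B Z) (hA : A ⊆ A') (hB : B ⊆ B')
    (hZ : Z' ⊆ Z) : Lk G A' B' Z' := by
  intro F
  obtain ⟨a, ha, b, hb, p, hp⟩ := h F
  exact ⟨a, hA ha, b, hB hb, p, fun x hx => ⟨(hp x hx).1, fun h => (hp x hx).2 (hZ h)⟩⟩

lemma Lk.pigeon {ι : Type*} (S : Finset ι) (A : ι → Set V) {B Z : Set V}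
    (hd : ∀ i j, i ≠ j → Disjoint (A i) (A j))
    (h : Lk G (⋃ i ∈ S, A i) B Z) :
    ∃ i ∈ S, Lk G (A i) B (Z ∪ ⋃ j ∈ {j | j ∈ S ∧ j ≠ i}, A j) := by
  classical
  by_contra hcon
  push Not at hcon
  simp only [Lk] at hcon
  push Not at hcon
  have hcon' : ∀ i, ∃ F : Finset V, i ∈ S → ∀ a ∈ A i, ∀ b ∈ B, ∀ p : G.Walk a b,
      ∃ x ∈ p.support, x ∉ F → x ∈ Z ∪ ⋃ j ∈ {j | j ∈ S ∧ j ≠ i}, A j := by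
    intro i
    by_cases hi : i ∈ S
    · obtain ⟨F, hF⟩ := hcon i hi
      exact ⟨F, fun _ => hF⟩
    · exact ⟨∅, fun h => absurd h hi⟩
  choose F hF using hcon'
  obtain ⟨a, ha, b, hb, p, hp⟩ := h (S.biUnion F)
  obtain ⟨a', ha', b', hb', q, -, hq, hqA, -⟩ := trunc _ _ p ha hb
  simp only [mem_iUnion] at ha'
  obtain ⟨i, hi, hai⟩ := ha'
  obtain ⟨x, hx, hxF⟩ := hF i hi a' hai b' hb' q
  have h1 := hp x (hq x hx)
  have h2 := hxF (fun h => h1.1 (Finset.mem_biUnion.mpr ⟨i, hi, h⟩))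
  rcases h2 with h2 | h2
  · exact h1.2 h2
  · simp only [mem_ofPred_eq, mem_iUnion] at h2
    obtain ⟨j, ⟨hj, hji⟩, hxj⟩ := h2
    have : x = a' := hqA x hx (by simp only [mem_iUnion]; exact ⟨j, hj, hxj⟩)
    subst this
    exact Set.disjoint_left.mp (hd j i hji) hxj hai

/-- A tail of a ray avoids a given finite set. -/
lemma ray_tail {f : ℕ → V} (hf : IsRay G f) (F : Finset V) : ∃ M, ∀ i, M ≤ i → f i ∉ F := by
  have hfin : (f ⁻¹' (F : Set V)).Finite := F.finite_toSet.preimage hf.1.injOn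
  obtain ⟨M, hM⟩ := hfin.bddAbove
  refine ⟨M + 1, fun i hi h => ?_⟩
  have := hM (show i ∈ f ⁻¹' (F : Set V) from h)
  omega

lemma Lk.trans_ray {f : ℕ → V} (hf : IsRay G f) {A B Z : Set V}
    (h1 : Lk G A (range f) Z) (h2 : Lk G (range f) B Z) (hZ : ∀ i, f i ∉ Z) : Lk G A B Z := by
  classical
  intro F
  obtain ⟨M, hM⟩ := ray_tail hf F
  obtain ⟨a, ha, _, ⟨i, rfl⟩, p, hp⟩ := h1 (F ∪ (Finset.range M).image f)
  obtain ⟨_, ⟨j, rfl⟩, b, hb, q, hq⟩ := h2 (F ∪ (Finset.range M).image f)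
  have hi : M ≤ i := by
    by_contra hlt
    exact (hp _ p.end_mem_support).1 (Finset.mem_union_right _
      (Finset.mem_image_of_mem f (Finset.mem_range.mpr (by omega))))
  have hj : M ≤ j := by
    by_contra hlt
    exact (hq _ q.start_mem_support).1 (Finset.mem_union_right _
      (Finset.mem_image_of_mem f (Finset.mem_range.mpr (by omega))))
  obtain ⟨s, hs⟩ := ray_seg' hf i j
  refine ⟨a, ha, b, hb, (p.append s).append q, fun x hx => ?_⟩
  rw [Walk.mem_support_append_iff, Walk.mem_support_append_iff] at hx
  rcases hx with (hx | hx) | hx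
  · exact ⟨fun h => (hp x hx).1 (Finset.mem_union_left _ h), (hp x hx).2⟩
  · obtain ⟨k, hk, rfl⟩ := hs x hx
    exact ⟨hM k (by omega), hZ k⟩
  · exact ⟨fun h => (hq x hx).1 (Finset.mem_union_left _ h), (hq x hx).2⟩

/-- Fan lemma. -/
lemma fan (U : ℕ → Set V) (hd : ∀ i j, i ≠ j → Disjoint (U i) (U j)) (X : Set V) (I : Set ℕ)
    (hno : ∀ r ∈ I, ¬ Lk G X (U r) (⋃ j ∈ I \ {r}, U j))
    (hyes : ∃ r ∈ I, Lk G X (U r) ∅) :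
    ∃ j : ℕ → ℕ, Function.Injective j ∧ (∀ n, j n ∈ I) ∧ ∃ W : ℕ → Finset V,
      (∀ m n, m < n → Disjoint (W m) (W n)) ∧
      ∀ n, ∃ a ∈ X, ∃ b ∈ U (j n), ∃ p : G.Walk a b, (∀ x ∈ p.support, x ∈ W n) ∧
        ∀ x ∈ p.support, ∀ l ∈ I, l ≠ j n → x ∉ U l := by
  classical
  have hno' : ∀ r, ∃ F : Finset V, r ∈ I → ∀ a ∈ X, ∀ b ∈ U r, ∀ p : G.Walk a b,
      ∃ x ∈ p.support, x ∉ F → x ∈ ⋃ j ∈ I \ {r}, U j := by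
    intro r
    by_cases hr : r ∈ I
    · have := hno r hr
      simp only [Lk] at this
      push Not at this
      obtain ⟨F, hF⟩ := this
      exact ⟨F, fun _ => hF⟩
    · exact ⟨∅, fun h => absurd h hr⟩
  choose F hF using hno'
  obtain ⟨r0, hr0, hlk⟩ := hyes
  let P : ℕ → ℕ × Finset V → Prop := fun _ y => y.1 ∈ I ∧
    ∃ a ∈ X, ∃ b ∈ U y.1, ∃ p : G.Walk a b, (∀ x ∈ p.support, x ∈ y.2) ∧
        ∀ x ∈ p.support, ∀ l ∈ I, l ≠ y.1 → x ∉ U l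
  let rel : ℕ × Finset V → ℕ × Finset V → Prop := fun x y => x.1 ≠ y.1 ∧ Disjoint x.2 y.2
  obtain ⟨f, hf1, hf2⟩ := exists_seq P rel (by
    intro _ s
    obtain ⟨a, ha, b, hb, p, hp⟩ := hlk (s.toFinset.biUnion fun x => x.2 ∪ F x.1)
    obtain ⟨a', ha', b', hb', q, -, hq, -, hqB⟩ := trunc X (⋃ j ∈ I, U j) p ha
      (by simp only [mem_iUnion]; exact ⟨r0, hr0, hb⟩)
    simp only [mem_iUnion] at hb'
    obtain ⟨j, hj, hbj⟩ := hb'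
    have havoid : ∀ x ∈ q.support, ∀ l ∈ I, l ≠ j → x ∉ U l := by
      intro x hx l hl hlj hxl
      have : x = b' := hqB x hx (by simp only [mem_iUnion]; exact ⟨l, hl, hxl⟩)
      subst this
      exact Set.disjoint_left.mp (hd l j hlj) hxl hbj
    have hpF : ∀ x ∈ q.support, ∀ y ∈ s, x ∉ y.2 ∧ x ∉ F y.1 := by
      intro x hx y hy
      have := (hp x (hq x hx)).1
      simp only [Finset.mem_biUnion, List.mem_toFinset, Finset.mem_union, not_exists, not_and,
        not_or] at this
      exact this y hy
    refine ⟨(j, q.support.toFinset), ⟨hj, a', ha', b', hbj, q, by simp, havoid⟩, ?_⟩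
    intro y hy
    refine ⟨?_, ?_⟩
    · rintro rfl
      obtain ⟨x, hx, hxF⟩ := hF y.1 hj a' ha' b' hbj q
      have := hxF (hpF x hx y hy).2
      simp only [mem_iUnion] at this
      obtain ⟨l, hl, hxl⟩ := this
      exact havoid x hx l hl.1 hl.2 hxl
    · rw [Finset.disjoint_right]
      intro x hx
      exact (hpF x (by simpa using hx) y hy).1)
  refine ⟨fun n => (f n).1, ?_, fun n => (hf1 n).1, fun n => (f n).2,
    fun m n h => (hf2 m n h).2, fun n => (hf1 n).2⟩
  intro m n hmn
  rcases lt_trichotomy m n with h | h | h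
  · exact absurd hmn (hf2 m n h).1
  · exact h
  · exact absurd hmn.symm (hf2 n m h).1

def Term (G : SimpleGraph V) (U : ℕ → Set V) (S : Finset ℕ) (I : Set ℕ) : Prop :=
  ∀ J ⊆ I, J.Infinite → ∀ r ∈ J, ¬ Lk G (⋃ i ∈ S, U i) (U r) (⋃ j ∈ J \ {r}, U j)

lemma eventually_disj {W : ℕ → Finset V} (hW : ∀ m n, m < n → Disjoint (W m) (W n))
    (F : Finset V) : ∃ M, ∀ n, M ≤ n → Disjoint (W n) F := by
  classical
  induction F using Finset.induction_on with
  | empty => exact ⟨0, by simp⟩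
  | insert a s _ ih =>
    obtain ⟨M, hM⟩ := ih
    by_cases h : ∃ n, a ∈ W n
    · obtain ⟨n, hn⟩ := h
      refine ⟨max M (n + 1), fun k hk => ?_⟩
      rw [Finset.disjoint_insert_right]
      exact ⟨Finset.disjoint_left.mp (hW n k (by omega)) hn, hM k (by omega)⟩
    · push Not at h
      exact ⟨M, fun k hk => by
        rw [Finset.disjoint_insert_right]; exact ⟨h k, hM k hk⟩⟩

lemma eventually_disj_ray {R : ℕ → ℕ → V}
    (hd : ∀ m n, m ≠ n → Disjoint (Set.range (R m)) (Set.range (R n)))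
    (F : Finset V) : ∃ M, ∀ n, M ≤ n → ∀ i, R n i ∉ F := by
  classical
  induction F using Finset.induction_on with
  | empty => exact ⟨0, by simp⟩
  | insert a s _ ih =>
    obtain ⟨M, hM⟩ := ih
    by_cases h : ∃ n, a ∈ range (R n)
    · obtain ⟨n, hn⟩ := h
      refine ⟨max M (n + 1), fun k hk i hi => ?_⟩
      rcases Finset.mem_insert.mp hi with hi | hi
      · exact Set.disjoint_left.mp (hd n k (by omega)) hn ⟨i, hi⟩
      · exact hM k (by omega) i hi
    · push Not at h
      refine ⟨M, fun k hk i hi => ?_⟩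
      rcases Finset.mem_insert.mp hi with hi | hi
      · exact h k ⟨i, hi⟩
      · exact hM k hk i hi

lemma term_contra {R : ℕ → ℕ → V} (hR : ∀ n, IsRay G (R n))
    (hd : ∀ m n, m ≠ n → Disjoint (Set.range (R m)) (Set.range (R n)))
    (hlk : ∀ m n, Lk G (range (R m)) (range (R n)) ∅)
    {S1 S2 : Finset ℕ} {I1 I2 : Set ℕ} (hS1 : S1.Nonempty) (hS2 : S2.Nonempty)
    (hI2 : I2.Infinite) (hSI : (S2 : Set ℕ) ⊆ I1) (hII : I2 ⊆ I1)
    (ht1 : Term G (fun n => range (R n)) S1 I1) (ht2 : Term G (fun n => range (R n)) S2 I2) :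
    False := by
  classical
  have hstart : ∀ S : Finset ℕ, S.Nonempty → ∀ r, Lk G (⋃ i ∈ S, range (R i)) (range (R r)) ∅ := by
    rintro S ⟨i, hi⟩ r
    exact (hlk i r).mono (fun x hx => by simp only [mem_iUnion]; exact ⟨i, hi, hx⟩)
      subset_rfl subset_rfl
  obtain ⟨j1, hj1, hj1I, W1, hW1, hp1⟩ := fan (G := G) (fun n => range (R n)) hd
    (⋃ i ∈ S1, range (R i)) I2 (ht1 I2 hII hI2)
    (by obtain ⟨r, hr⟩ := hI2.nonempty; exact ⟨r, hr, hstart S1 hS1 r⟩)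
  have hI3 : (range j1).Infinite := Set.infinite_range_of_injective hj1
  have hI32 : range j1 ⊆ I2 := by rintro _ ⟨n, rfl⟩; exact hj1I n
  obtain ⟨j2, hj2, hj2I, W2, hW2, hp2⟩ := fan (G := G) (fun n => range (R n)) hd
    (⋃ i ∈ S2, range (R i)) (range j1) (ht2 (range j1) hI32 hI3)
    (by obtain ⟨r, hr⟩ := hI3.nonempty; exact ⟨r, hr, hstart S2 hS2 r⟩)
  choose k hk using hj2I
  have hkinj : Function.Injective k := by
    intro a b hab
    apply hj2
    rw [← hk a, ← hk b, hab]
  -- even-indexed rays are kept, odd-indexed rays are used as connectors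
  let E : Set ℕ := range fun n => j2 (2 * n)
  have hE : E.Infinite := Set.infinite_range_of_injective (by
    intro a b hab
    have := hj2 hab
    omega)
  have hE3 : E ⊆ range j1 := by rintro _ ⟨n, rfl⟩; exact ⟨_, hk _⟩
  have key : Lk G (⋃ i ∈ S2, range (R i)) (⋃ i ∈ S1, range (R i)) (⋃ j ∈ E, range (R j)) := by
    intro F
    obtain ⟨M1, hM1⟩ := eventually_disj hW1 F
    obtain ⟨M2, hM2⟩ := eventually_disj hW2 F
    obtain ⟨M3, hM3⟩ := eventually_disj_ray hd F
    -- choose an odd index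
    have hfin : {n | k (2 * n + 1) < M1 ∨ 2 * n + 1 < M2 ∨ j2 (2 * n + 1) < M3}.Finite := by
      refine Set.Finite.union ?_ (Set.Finite.union ?_ ?_)
      · exact (Set.finite_Iio M1).preimage (f := fun n => k (2 * n + 1)) (by
          intro a _ b _ hab
          have := hkinj hab
          omega)
      · exact (Set.finite_Iio M2).preimage (f := fun n => 2 * n + 1) (by
          intro a _ b _ hab
          simp at hab; omega)
      · exact (Set.finite_Iio M3).preimage (f := fun n => j2 (2 * n + 1)) (by
          intro a _ b _ hab
          have := hj2 hab
          omega)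
    obtain ⟨n, hn⟩ := hfin.infinite_compl.nonempty
    simp only [mem_compl_iff, mem_ofPred_eq, not_or, not_lt] at hn
    obtain ⟨hn1, hn2, hn3⟩ := hn
    obtain ⟨a1, ha1, b1, hb1, p1, hp1W, hp1a⟩ := hp1 (k (2 * n + 1))
    obtain ⟨a2, ha2, b2, hb2, p2, hp2W, hp2a⟩ := hp2 (2 * n + 1)
    rw [hk] at hb1 hp1a
    have hjE : j2 (2 * n + 1) ∉ E := by
      rintro ⟨m, hm⟩
      have := hj2 hm
      omega
    obtain ⟨i1, rfl⟩ := hb1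
    obtain ⟨i2, rfl⟩ := hb2
    obtain ⟨s, hs⟩ := ray_seg' (hR (j2 (2 * n + 1))) i2 i1
    refine ⟨a2, ha2, a1, ha1, (p2.append s).append p1.reverse, fun x hx => ?_⟩
    rw [Walk.mem_support_append_iff, Walk.mem_support_append_iff] at hx
    simp only [mem_iUnion, not_exists]
    rcases hx with (hx | hx) | hx
    · refine ⟨Finset.disjoint_left.mp (hM2 _ hn2) (hp2W x hx), fun l hl => ?_⟩
      exact hp2a x hx l (hE3 hl) (fun h => hjE (h ▸ hl))
    · obtain ⟨i, -, rfl⟩ := hs x hx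
      refine ⟨hM3 _ hn3 i, fun l hl => ?_⟩
      exact Set.disjoint_left.mp (hd (j2 (2 * n + 1)) l (fun h => hjE (h ▸ hl))) ⟨i, rfl⟩
    · have hx : x ∈ p1.support := by simpa using hx
      refine ⟨Finset.disjoint_left.mp (hM1 _ hn1) (hp1W x hx), fun l hl => ?_⟩
      exact hp1a x hx l (hI32 (hE3 hl)) (fun h => hjE (h ▸ hl))
  obtain ⟨b, hb, hlkb⟩ := key.pigeon S2 (fun n => range (R n)) hd
  refine ht1 (insert b E) ?_ (hE.mono (Set.subset_insert _ _)) b (Set.mem_insert _ _)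
    (hlkb.symm.mono subset_rfl subset_rfl ?_)
  · intro x hx
    rcases hx with rfl | hx
    · exact hSI hb
    · exact hII (hI32 (hE3 hx))
  · intro x hx
    left
    simp only [mem_iUnion] at hx ⊢
    obtain ⟨l, hl, hx⟩ := hx
    exact ⟨l, hl.1.resolve_left hl.2, hx⟩

lemma exists_nonterm {R : ℕ → ℕ → V} (hR : ∀ n, IsRay G (R n))
    (hd : ∀ m n, m ≠ n → Disjoint (Set.range (R m)) (Set.range (R n)))
    (hlk : ∀ m n, Lk G (range (R m)) (range (R n)) ∅) :
    ∃ I0 : Set ℕ, I0.Infinite ∧ ∀ S : Finset ℕ, S.Nonempty → (S : Set ℕ) ⊆ I0 →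
      ∀ I ⊆ I0, I.Infinite → Disjoint (S : Set ℕ) I → ¬ Term G (fun n => range (R n)) S I := by
  by_contra hcon
  push Not at hcon
  obtain ⟨S1, hS1, -, I1, -, hI1, -, ht1⟩ := hcon univ Set.infinite_univ
  obtain ⟨S2, hS2, hSI, I2, hII, hI2, -, ht2⟩ := hcon I1 hI1
  exact term_contra hR hd hlk hS1 hS2 hI2 hSI hII ht1 ht2

lemma exists_tree {R : ℕ → ℕ → V} (hR : ∀ n, IsRay G (R n))
    (hd : ∀ m n, m ≠ n → Disjoint (Set.range (R m)) (Set.range (R n)))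
    (hlk : ∀ m n, Lk G (range (R m)) (range (R n)) ∅) :
    ∃ r : ℕ → ℕ, Function.Injective r ∧ ∀ n, ∃ p ≤ n,
      Lk G (range (R (r p))) (range (R (r (n + 1))))
        (⋃ m ∈ {m | m ≠ p ∧ m ≠ n + 1}, range (R (r m))) := by
  classical
  obtain ⟨I0, hI0, hnt⟩ := exists_nonterm hR hd hlk
  obtain ⟨i0, hi0⟩ := hI0.nonempty
  let St := {x : Finset ℕ × Set ℕ // x.1.Nonempty ∧ (x.1 : Set ℕ) ⊆ I0 ∧ x.2 ⊆ I0 ∧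
    x.2.Infinite ∧ Disjoint (x.1 : Set ℕ) x.2}
  have step : ∀ x : St, ∃ r ∈ x.1.2, ∃ y : St, y.1.1 = insert r x.1.1 ∧ y.1.2 ⊆ x.1.2 ∧
      Lk G (⋃ i ∈ x.1.1, range (R i)) (range (R r)) (⋃ j ∈ y.1.2, range (R j)) := by
    rintro ⟨⟨S, I⟩, h1, h2, h3, h4, h5⟩
    have := hnt S h1 h2 I h3 h4 h5
    simp only [Term] at this
    push Not at this
    obtain ⟨J, hJI, hJ, r, hr, hl⟩ := this
    refine ⟨r, hJI hr, ⟨⟨insert r S, J \ {r}⟩, ?_, ?_, ?_, ?_, ?_⟩, rfl, ?_, hl⟩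
    · exact Finset.insert_nonempty _ _
    · intro x hx
      simp only [Finset.coe_insert, mem_insert_iff] at hx
      rcases hx with rfl | hx
      · exact h3 (hJI hr)
      · exact h2 hx
    · exact fun x hx => h3 (hJI hx.1)
    · exact hJ.sdiff (Set.finite_singleton r)
    · rw [Set.disjoint_left]
      intro x hx hxJ
      simp only [Finset.coe_insert, mem_insert_iff] at hx
      rcases hx with rfl | hx
      · exact hxJ.2 rfl
      · exact Set.disjoint_left.mp h5 hx (hJI hxJ.1)
    · exact fun x hx => hJI hx.1
  choose rr hrr nx hnx1 hnx2 hnx3 using step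
  let s0 : St := ⟨⟨{i0}, I0 \ {i0}⟩, by simp, by simpa using hi0, Set.sdiff_subset,
    hI0.sdiff (Set.finite_singleton _), by simp⟩
  let σ : ℕ → St := fun n => nx^[n] s0
  have hσ : ∀ n, σ (n + 1) = nx (σ n) := fun n => Function.iterate_succ_apply' _ _ _
  let r : ℕ → ℕ := fun n => match n with
    | 0 => i0
    | n + 1 => rr (σ n)
  have hS : ∀ n, (σ n).1.1 = (Finset.range (n + 1)).image r := by
    intro n
    induction n with
    | zero => rfl
    | succ n ih =>
      rw [hσ, hnx1, ih, Finset.range_add_one (n := n + 1), Finset.image_insert]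
  have hI : ∀ m n, m ≤ n → (σ n).1.2 ⊆ (σ m).1.2 := by
    intro m n hmn
    induction n, hmn using Nat.le_induction with
    | base => exact subset_rfl
    | succ n _ ih => rw [hσ]; exact (hnx2 _).trans ih
  have hrI : ∀ m n, m < n → r n ∈ (σ m).1.2 := by
    intro m n hmn
    obtain ⟨n, rfl⟩ : ∃ k, n = k + 1 := ⟨n - 1, by omega⟩
    exact hI m n (by omega) (hrr (σ n))
  have hlt : ∀ m n, m < n → r m ≠ r n := by
    intro m n hmn heq
    have h1 := (σ m).2.2.2.2.2
    refine Set.disjoint_left.mp h1 (?_ : r m ∈ _) (heq ▸ hrI m n hmn)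
    rw [hS]
    simp only [Finset.coe_image]
    exact ⟨m, by simp, rfl⟩
  have hinj : Function.Injective r := by
    intro m n hmn
    rcases lt_trichotomy m n with h | h | h
    · exact absurd hmn (hlt _ _ h)
    · exact h
    · exact absurd hmn.symm (hlt _ _ h)
  refine ⟨r, hinj, fun n => ?_⟩
  have h3 := hnx3 (σ n)
  rw [← hσ n, hS n] at h3
  obtain ⟨q, hq, hql⟩ := h3.pigeon _ (fun n => range (R n)) hd
  obtain ⟨p, hp, rfl⟩ := Finset.mem_image.mp hq
  refine ⟨p, by have := Finset.mem_range.mp hp; omega, hql.mono subset_rfl subset_rfl ?_⟩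
  intro x hx
  simp only [mem_iUnion, mem_union] at hx ⊢
  obtain ⟨m, hm, hx⟩ := hx
  rcases lt_or_ge (n + 1) m with h | h
  · left
    exact ⟨r m, hrI _ _ h, hx⟩
  · right
    refine ⟨r m, ⟨Finset.mem_image_of_mem r (Finset.mem_range.mpr ?_), fun h => hm.1 (hinj h)⟩, hx⟩
    have := hm.2
    omega

/-- A predecessor function has an infinite fibre or an infinite chain. -/
lemma star_or_chain (p : ℕ → ℕ) (hp : ∀ n, p (n + 1) ≤ n) :
    (∃ c, {n | p (n + 1) = c}.Infinite) ∨
      ∃ g : ℕ → ℕ, StrictMono g ∧ ∀ i, ∃ n, g (i + 1) = n + 1 ∧ p (n + 1) = g i := by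
  by_cases hc : ∃ c, {n | p (n + 1) = c}.Infinite
  · exact Or.inl hc
  right
  push Not at hc
  let pp : ℕ → ℕ := fun n => match n with
    | 0 => 0
    | n + 1 => p (n + 1)
  let D : ℕ → Set ℕ := fun a => {n | ∃ k, pp^[k] n = a}
  have hstep : ∀ a : {a // (D a).Infinite}, ∃ b : {a // (D a).Infinite},
      ∃ n, b.1 = n + 1 ∧ p (n + 1) = a.1 := by
    rintro ⟨a, ha⟩
    by_contra hcon
    push Not at hcon
    have hsub : D a ⊆ {a} ∪ ⋃ n ∈ {n | p (n + 1) = a}, D (n + 1) := by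
      rintro m ⟨k, hk⟩
      induction k generalizing m with
      | zero => left; exact hk
      | succ k ih =>
        rw [Function.iterate_succ_apply'] at hk
        rcases hq : pp^[k] m with _ | q
        · rw [hq] at hk
          exact ih (by rw [hq]; exact hk)
        · rw [hq] at hk
          right
          simp only [mem_iUnion]
          exact ⟨q, hk, k, hq⟩
    refine ha (Set.Finite.subset (Set.Finite.union (Set.finite_singleton a)
      (Set.Finite.biUnion (Set.not_infinite.mp (fun h => h (hc a))) ?_)) hsub)
    intro n hn
    by_contra hinf
    exact hcon ⟨n + 1, hinf⟩ n rfl hn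
  choose nx hnx using hstep
  have h0 : (D 0).Infinite := by
    have : D 0 = univ := by
      ext n
      simp only [mem_univ, iff_true]
      induction n using Nat.strong_induction_on with
      | _ n ih =>
        rcases n with _ | n
        · exact ⟨0, rfl⟩
        · obtain ⟨k, hk⟩ := ih (p (n + 1)) (by have := hp n; omega)
          exact ⟨k + 1, hk⟩
    rw [this]; exact Set.infinite_univ
  let g : ℕ → {a // (D a).Infinite} := fun n => nx^[n] ⟨0, h0⟩
  have hg : ∀ i, ∃ n, (g (i + 1)).1 = n + 1 ∧ p (n + 1) = (g i).1 := by
    intro i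
    have : g (i + 1) = nx (g i) := Function.iterate_succ_apply' _ _ _
    rw [this]
    exact hnx _
  refine ⟨fun n => (g n).1, strictMono_nat_of_lt_succ fun i => ?_, hg⟩
  obtain ⟨n, h1, h2⟩ := hg i
  have := hp n
  omega

lemma exists_path_rays {R : ℕ → ℕ → V} (hR : ∀ n, IsRay G (R n))
    (hd : ∀ m n, m ≠ n → Disjoint (Set.range (R m)) (Set.range (R n)))
    (hlk : ∀ m n, Lk G (range (R m)) (range (R n)) ∅) :
    ∃ g : ℕ → ℕ, Function.Injective g ∧ ∀ i,
      Lk G (range (R (g i))) (range (R (g (i + 1))))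
        (⋃ m ∈ {m | m ≠ i ∧ m ≠ i + 1}, range (R (g m))) := by
  obtain ⟨r, hr, htree⟩ := exists_tree hR hd hlk
  choose p hp hl using htree
  rcases star_or_chain (fun n => p (n - 1)) (fun n => hp n) with ⟨c, hc⟩ | ⟨g, hg, hgp⟩
  · simp only [Nat.add_sub_cancel] at hc
    let e : ℕ → ℕ := Nat.nth (fun n => p n = c)
    have he : StrictMono e := Nat.nth_strictMono hc
    have hpe : ∀ i, p (e i) = c := fun i => Nat.nth_mem_of_infinite hc i
    have hce : ∀ i, c ≠ e i + 1 := by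
      intro i h
      have := hp (e i)
      rw [hpe] at this
      omega
    have hginj : Function.Injective fun i => r (e i + 1) := by
      intro a b hab
      have := hr hab
      exact he.injective (by omega)
    refine ⟨fun i => r (e i + 1), hginj, fun i => ?_⟩
    have h : ∀ j, j = i ∨ j = i + 1 → Lk G (range (R (r c))) (range (R (r (e j + 1))))
        (⋃ m ∈ {m | m ≠ i ∧ m ≠ i + 1}, range (R (r (e m + 1)))) := by
      intro j hj
      have h1 := hl (e j)
      rw [hpe] at h1
      refine h1.mono subset_rfl subset_rfl ?_
      intro x hx
      simp only [mem_iUnion] at hx ⊢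
      obtain ⟨m, ⟨hm1, hm2⟩, hx⟩ := hx
      refine ⟨e m + 1, ⟨(hce m).symm, ?_⟩, hx⟩
      intro h
      have : m = j := he.injective (by omega)
      omega
    refine (h i (Or.inl rfl)).symm.trans_ray (hR _) (h (i + 1) (Or.inr rfl)) ?_
    intro k hk
    simp only [mem_iUnion] at hk
    obtain ⟨m, -, hk⟩ := hk
    exact Set.disjoint_left.mp (hd (r c) (r (e m + 1)) (fun h => hce m (hr h))) ⟨k, rfl⟩ hk
  · refine ⟨fun i => r (g i), hr.comp hg.injective, fun i => ?_⟩
    obtain ⟨n, h1, h2⟩ := hgp i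
    simp only [Nat.add_sub_cancel] at h2
    have h3 := hl n
    rw [h2, ← h1] at h3
    refine h3.mono subset_rfl subset_rfl ?_
    intro x hx
    simp only [mem_iUnion] at hx ⊢
    obtain ⟨m, ⟨hm1, hm2⟩, hx⟩ := hx
    exact ⟨g m, ⟨fun h => hm1 (hg.injective h), fun h => hm2 (hg.injective h)⟩, hx⟩

/-- The data of a rung between the rays `T c` and `T (c + 1)`. -/
def Rung (G : SimpleGraph V) (T : ℕ → ℕ → V) (c s t : ℕ) (W : Finset V) : Prop :=
  ∃ p : G.Walk (T c s) (T (c + 1) t), p.IsPath ∧ (∀ x ∈ p.support, x ∈ W) ∧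
    ∀ x ∈ W, ∀ l i, x = T l i → (l = c ∧ i = s) ∨ (l = c + 1 ∧ i = t)

lemma exists_rungs {T : ℕ → ℕ → V} (hT : ∀ n, IsRay G (T n))
    (hl : ∀ i, Lk G (range (T i)) (range (T (i + 1)))
        (⋃ m ∈ {m | m ≠ i ∧ m ≠ i + 1}, range (T m))) (c : ℕ → ℕ) :
    ∃ (s t : ℕ → ℕ) (W : ℕ → Finset V), (∀ n, Rung G T (c n) (s n) (t n) (W n)) ∧
      ∀ m n, m < n → Disjoint (W m) (W n) ∧ s m < s n ∧ s m < t n ∧ t m < s n ∧ t m < t n := by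
  classical
  obtain ⟨f, hf1, hf2⟩ := exists_seq
    (fun n (y : ℕ × ℕ × Finset V) => Rung G T (c n) y.1 y.2.1 y.2.2)
    (fun x y => Disjoint x.2.2 y.2.2 ∧ x.1 < y.1 ∧ x.1 < y.2.1 ∧ x.2.1 < y.1 ∧ x.2.1 < y.2.1) (by
    intro n L
    obtain ⟨N, hN⟩ : ∃ N, ∀ x ∈ L, x.1 ≤ N ∧ x.2.1 ≤ N := by
      induction L with
      | nil => exact ⟨0, by simp⟩
      | cons a L ih =>
        obtain ⟨N, hN⟩ := ih
        refine ⟨max N (max a.1 a.2.1), ?_⟩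
        intro x hx
        rcases List.mem_cons.mp hx with rfl | hx
        · omega
        · have := hN x hx
          omega
    obtain ⟨a, ha, b, hb, p, hp⟩ := hl (c n) (L.toFinset.biUnion (fun x => x.2.2) ∪
      ((Finset.range (N + 1)).image (T (c n)) ∪ (Finset.range (N + 1)).image (T (c n + 1))))
    obtain ⟨_, ⟨s, rfl⟩, _, ⟨t, rfl⟩, q, hqp, hq, hqA, hqB⟩ := trunc _ _ p ha hb
    have hs : N < s := by
      by_contra h
      refine (hp _ (hq _ q.start_mem_support)).1 (Finset.mem_union_right _
        (Finset.mem_union_left _ (Finset.mem_image_of_mem _ (Finset.mem_range.mpr ?_))))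
      omega
    have ht : N < t := by
      by_contra h
      refine (hp _ (hq _ q.end_mem_support)).1 (Finset.mem_union_right _
        (Finset.mem_union_right _ (Finset.mem_image_of_mem _ (Finset.mem_range.mpr ?_))))
      omega
    refine ⟨(s, t, q.support.toFinset), ⟨q, hqp, by simp, ?_⟩, ?_⟩
    · intro x hx l i hxi
      have hx : x ∈ q.support := by simpa using hx
      subst hxi
      by_cases h1 : l = c n
      · subst h1
        exact Or.inl ⟨rfl, (hT _).1 (hqA _ hx ⟨i, rfl⟩)⟩
      by_cases h2 : l = c n + 1
      · subst h2
        exact Or.inr ⟨rfl, (hT _).1 (hqB _ hx ⟨i, rfl⟩)⟩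
      exfalso
      refine (hp _ (hq _ hx)).2 ?_
      simp only [mem_iUnion]
      exact ⟨l, ⟨h1, h2⟩, i, rfl⟩
    · intro y hy
      have := hN y hy
      refine ⟨?_, by simp only; omega, by simp only; omega, by simp only; omega,
        by simp only; omega⟩
      rw [Finset.disjoint_right]
      intro x hx hxy
      have hx : x ∈ q.support := by simpa using hx
      exact (hp _ (hq _ hx)).1 (Finset.mem_union_left _
        (Finset.mem_biUnion.mpr ⟨y, by simpa using hy, hxy⟩)))
  exact ⟨fun n => (f n).1, fun n => (f n).2.1, fun n => (f n).2.2, hf1, hf2⟩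

/-- Arranging the rungs in a grid pattern. -/
lemma exists_layout {T : ℕ → ℕ → V} (hT : ∀ n, IsRay G (T n))
    (hl : ∀ i, Lk G (range (T i)) (range (T (i + 1)))
        (⋃ m ∈ {m | m ≠ i ∧ m ≠ i + 1}, range (T m))) :
    ∃ (pos : ℕ → ℕ → ℕ) (W : ℕ → ℕ → Finset V), (∀ y, StrictMono (pos y)) ∧
      (∀ x y, x % 2 = y % 2 → Rung G T y (pos y x) (pos (y + 1) x) (W x y)) ∧
      ∀ x y x' y', (x, y) ≠ (x', y') → Disjoint (W x y) (W x' y') := by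
  obtain ⟨s, t, W, hr, hm⟩ := exists_rungs hT hl (fun n => n.unpair.2 - 2 * n.unpair.1)
  let key : ℕ → ℕ → ℕ := fun x y => Nat.pair x (2 * x + y)
  have hkey : ∀ x y, (key x y).unpair.2 - 2 * (key x y).unpair.1 = y := by
    intro x y
    simp [key]
  have hlt : ∀ x y x' y', 2 * x + y < 2 * x' + y' → key x y < key x' y' := by
    intro x y x' y' h
    have e : ∀ x y, key x y = (2 * x + y) * (2 * x + y) + x := by
      intro x y
      simp only [key, Nat.pair]
      split_ifs with h
      · rfl
      · have : x = 0 := by omega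
        have : y = 0 := by omega
        subst_vars
        rfl
    rw [e, e]
    nlinarith
  refine ⟨fun y x => if x % 2 = y % 2 ∨ y = 0 then s (key x y) else t (key x (y - 1)),
    fun x y => W (key x y), ?_, ?_, ?_⟩
  · intro y x x' h
    have h1 := hm (key x y) (key x' y) (hlt _ _ _ _ (by omega))
    have h2 := hm (key x y) (key x' (y - 1)) (hlt _ _ _ _ (by omega))
    have h3 := hm (key x (y - 1)) (key x' y) (hlt _ _ _ _ (by omega))
    have h4 := hm (key x (y - 1)) (key x' (y - 1)) (hlt _ _ _ _ (by omega))
    simp only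
    split_ifs
    · exact h1.2.1
    · exact h2.2.2.1
    · exact h3.2.2.2.1
    · exact h4.2.2.2.2
  · intro x y hxy
    have h := hr (key x y)
    simp only [hkey] at h
    beta_reduce
    rw [if_pos (Or.inl hxy), if_neg (by omega)]
    exact h
  · intro x y x' y' hne
    have : key x y ≠ key x' y' := by
      intro h
      have h1 := congrArg Nat.unpair h
      simp only [key, Nat.unpair_pair, Prod.mk.injEq] at h1
      exact hne (by rw [Prod.mk.injEq]; omega)
    rcases lt_or_gt_of_ne this with h | h
    · exact (hm _ _ h).1
    · exact (hm _ _ h).1.symm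

lemma grid_of_layout {T : ℕ → ℕ → V} (hT : ∀ n, IsRay G (T n))
    (hd : ∀ m n, m ≠ n → Disjoint (Set.range (T m)) (Set.range (T n)))
    (pos : ℕ → ℕ → ℕ) (W : ℕ → ℕ → Finset V) (hpos : ∀ y, StrictMono (pos y))
    (hW : ∀ x y, x % 2 = y % 2 → Rung G T y (pos y x) (pos (y + 1) x) (W x y))
    (hdW : ∀ x y x' y', (x, y) ≠ (x', y') → Disjoint (W x y) (W x' y')) :
    IsTopMinor hexGrid G := by
  classical
  have hTinj : ∀ l i l' i', T l i = T l' i' → l = l' ∧ i = i' := by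
    intro l i l' i' h
    by_cases hl : l = l'
    · subst hl
      exact ⟨rfl, (hT l).1 h⟩
    · exact absurd ⟨i', h.symm⟩ (Set.disjoint_left.mp (hd l l' hl) ⟨i, rfl⟩)
  let f : ℕ × ℕ → V := fun w => T w.2 (pos w.2 w.1)
  have hf : Function.Injective f := by
    rintro ⟨x, y⟩ ⟨x', y'⟩ h
    obtain ⟨h1, h2⟩ := hTinj _ _ _ _ h
    simp only at h1 h2
    subst h1
    rw [(hpos _).injective h2]
  -- the vertex sets of the subdivided edges
  let HS : ℕ → ℕ → Set V := fun x y => {z | ∃ k, pos y x ≤ k ∧ k ≤ pos y (x + 1) ∧ T y k = z}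
  let Q : ∀ a b : ℕ × ℕ, G.Walk (f a) (f b) → Prop := fun a b p => ∃ x y,
    (s(a, b) = s((x, y), (x + 1, y)) ∧ ∀ z ∈ p.support, z ∈ HS x y) ∨
    (x % 2 = y % 2 ∧ s(a, b) = s((x, y), (x, y + 1)) ∧ ∀ z ∈ p.support, z ∈ W x y)
  have hex1 : ∀ a b : ℕ × ℕ, ((a.2 = b.2 ∧ b.1 = a.1 + 1) ∨
      (a.1 = b.1 ∧ b.2 = a.2 + 1 ∧ a.1 % 2 = a.2 % 2)) →
      ∃ p : G.Walk (f a) (f b), p.IsPath ∧ Q a b p := by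
    rintro ⟨x, y⟩ ⟨x', y'⟩ h
    simp only at h
    rcases h with ⟨rfl, rfl⟩ | ⟨rfl, rfl, h⟩
    · obtain ⟨p, hp⟩ := ray_seg (hT y) (pos y x) (pos y (x + 1))
        ((hpos y).monotone (Nat.le_succ x))
      exact ⟨p.bypass, p.bypass_isPath, x, y, Or.inl ⟨rfl, fun z hz =>
        hp z (p.support_bypass_subset_support hz)⟩⟩
    · obtain ⟨p, hp, hpW, -⟩ := hW x y h
      exact ⟨p, hp, x, y, Or.inr ⟨h, rfl, hpW⟩⟩
  have hex : ∀ a b : ℕ × ℕ, hexGrid.Adj a b → ∃ p : G.Walk (f a) (f b), p.IsPath ∧ Q a b p := by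
    intro a b h
    rw [hexGrid, SimpleGraph.fromRel_adj] at h
    rcases h.2 with h | h
    · exact hex1 a b h
    · obtain ⟨p, hp, x, y, hQ⟩ := hex1 b a h
      refine ⟨p.reverse, hp.reverse, x, y, ?_⟩
      rw [Sym2.eq_swap]
      simpa using hQ
  choose P hP1 hP2 using hex
  -- incidences
  have hH : ∀ x y l k, T l k ∈ HS x y → l = y ∧ pos y x ≤ k ∧ k ≤ pos y (x + 1) := by
    rintro x y l k ⟨k', h1, h2, h3⟩
    obtain ⟨rfl, rfl⟩ := hTinj _ _ _ _ h3
    exact ⟨rfl, h1, h2⟩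
  have hHf : ∀ x y w, f w ∈ HS x y → w = (x, y) ∨ w = (x + 1, y) := by
    rintro x y ⟨u, v⟩ h
    obtain ⟨h1, h2, h3⟩ := hH _ _ _ _ h
    simp only at h1
    subst h1
    have h2 := (hpos v).le_iff_le.mp h2
    have h3 := (hpos v).le_iff_le.mp h3
    simp only [Prod.mk.injEq, and_true]
    omega
  have hWT : ∀ x y, x % 2 = y % 2 → ∀ z ∈ W x y, ∀ l i, z = T l i →
      z = f (x, y) ∨ z = f (x, y + 1) := by
    intro x y h z hz l i hzi
    obtain ⟨p, -, -, hp⟩ := hW x y h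
    rcases hp z hz l i hzi with ⟨rfl, rfl⟩ | ⟨rfl, rfl⟩
    · exact Or.inl hzi
    · exact Or.inr hzi
  have hmem : ∀ {a b c d : ℕ × ℕ}, s(a, b) = s(c, d) → ∀ w, (w = a ∨ w = b) ↔ (w = c ∨ w = d) := by
    intro a b c d h w
    rw [← Sym2.mem_iff, h, Sym2.mem_iff]
  have hmemf : ∀ {a b c d : ℕ × ℕ}, s(a, b) = s(c, d) → ∀ z,
      (z = f a ∨ z = f b) ↔ (z = f c ∨ z = f d) := by
    intro a b c d h z
    rcases Sym2.eq_iff.mp h with ⟨rfl, rfl⟩ | ⟨rfl, rfl⟩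
    · rfl
    · exact or_comm
  have hHV : ∀ x y x' y', x' % 2 = y' % 2 → ∀ z ∈ HS x y, z ∈ W x' y' →
      (z = f (x, y) ∨ z = f (x + 1, y)) ∧ (z = f (x', y') ∨ z = f (x', y' + 1)) := by
    rintro x y x' y' hpar z hz hzW
    have h1 : z = f (x', y') ∨ z = f (x', y' + 1) := by
      obtain ⟨k, -, -, hk⟩ := hz
      exact hWT x' y' hpar z hzW _ _ hk.symm
    refine ⟨?_, h1⟩
    rcases h1 with rfl | rfl
    · exact (hHf _ _ _ hz).imp (congrArg f) (congrArg f)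
    · exact (hHf _ _ _ hz).imp (congrArg f) (congrArg f)
  refine ⟨f, hf, fun a b h => P a b h, fun a b h => hP1 a b h, ?_, ?_⟩
  · intro a b h w hw
    obtain ⟨x, y, ⟨hs, hsup⟩ | ⟨hpar, hs, hsup⟩⟩ := hP2 a b h
    · rw [hmem hs]
      exact hHf _ _ _ (hsup _ hw)
    · rw [hmem hs]
      exact (hWT x y hpar _ (hsup _ hw) _ _ rfl).imp (fun h => hf h) (fun h => hf h)
  · intro a b h a' b' h' hne z hz hz'
    obtain ⟨x, y, ⟨hs, hsup⟩ | ⟨hpar, hs, hsup⟩⟩ := hP2 a b h <;>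
    obtain ⟨x', y', ⟨hs', hsup'⟩ | ⟨hpar', hs', hsup'⟩⟩ := hP2 a' b' h' <;>
    rw [hmemf hs, hmemf hs'] <;> rw [hs, hs'] at hne <;>
    have hz := hsup z hz <;> have hz' := hsup' z hz'
    · obtain ⟨k, hk1, hk2, rfl⟩ := hz
      obtain ⟨rfl, hk3, hk4⟩ := hH _ _ _ _ hz'
      have hx : x ≠ x' := by
        rintro rfl
        exact hne rfl
      have h1 := (hpos y).le_iff_le.mp (hk1.trans hk4)
      have h2 := (hpos y).le_iff_le.mp (hk3.trans hk2)
      have : x' = x + 1 ∨ x = x' + 1 := by omega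
      rcases this with rfl | rfl
      · have : k = pos y (x + 1) := by omega
        subst this
        exact ⟨Or.inr rfl, Or.inl rfl⟩
      · have : k = pos y (x' + 1) := by omega
        subst this
        exact ⟨Or.inl rfl, Or.inr rfl⟩
    · exact hHV _ _ _ _ hpar' _ hz hz'
    · exact (hHV _ _ _ _ hpar _ hz' hz).symm
    · exfalso
      refine Finset.disjoint_left.mp (hdW x y x' y' ?_) hz hz'
      intro h
      rw [Prod.mk.injEq] at h
      obtain ⟨rfl, rfl⟩ := h
      exact hne rfl

lemma forward (h : HasThickEnd G) : IsTopMinor hexGrid G := by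
  obtain ⟨R, hR, hd, heq⟩ := h
  have hlk : ∀ m n, Lk G (range (R m)) (range (R n)) ∅ := by
    intro m n F
    obtain ⟨i, j, -, -, p, hp⟩ := heq m n F
    exact ⟨_, ⟨i, rfl⟩, _, ⟨j, rfl⟩, p, fun x hx => ⟨hp x hx, fun h => h⟩⟩
  obtain ⟨g, hg, hl⟩ := exists_path_rays hR hd hlk
  have hT : ∀ n, IsRay G (R (g n)) := fun n => hR _
  have hdT : ∀ m n, m ≠ n → Disjoint (Set.range (R (g m))) (Set.range (R (g n))) :=
    fun m n h => hd _ _ (fun h' => h (hg h'))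
  obtain ⟨pos, W, h1, h2, h3⟩ := exists_layout (T := fun n => R (g n)) hT hl
  exact grid_of_layout (T := fun n => R (g n)) hT hdT pos W h1 h2 h3

/-- Infinite concatenation of paths into a ray. -/
lemma concat_ray (v : ℕ → V) (p : ∀ k, G.Walk (v k) (v (k + 1))) (hp : ∀ k, (p k).IsPath)
    (hv : Function.Injective v)
    (hmeet : ∀ j k, j < k → ∀ x ∈ (p j).support, x ∈ (p k).support → x = v (j + 1)) :
    ∃ R : ℕ → V, IsRay G R ∧ (∀ n, ∃ k, R n ∈ (p k).support) ∧
      ∀ k, ∃ n, R n = v k ∧ ∀ i, ∃ j ≥ k, R (n + i) ∈ (p j).support := by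
  have hlen : ∀ k, 0 < (p k).length := by
    intro k
    rw [Nat.pos_iff_ne_zero]
    intro h
    have := hv (Walk.eq_of_length_eq_zero h)
    omega
  let nx : ℕ × ℕ → ℕ × ℕ := fun s =>
    if s.2 + 1 < (p s.1).length then (s.1, s.2 + 1) else (s.1 + 1, 0)
  have hnx1 : ∀ s : ℕ × ℕ, s.2 + 1 < (p s.1).length → nx s = (s.1, s.2 + 1) :=
    fun s h => if_pos h
  have hnx2 : ∀ s : ℕ × ℕ, ¬ s.2 + 1 < (p s.1).length → nx s = (s.1 + 1, 0) :=
    fun s h => if_neg h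
  let σ : ℕ → ℕ × ℕ := fun n => nx^[n] (0, 0)
  have hσ : ∀ n, σ (n + 1) = nx (σ n) := fun n => Function.iterate_succ_apply' _ _ _
  have hσlt : ∀ n, (σ n).2 < (p (σ n).1).length := by
    intro n
    induction n with
    | zero => exact hlen 0
    | succ n ih =>
      rw [hσ]
      by_cases h : (σ n).2 + 1 < (p (σ n).1).length
      · rw [hnx1 _ h]
        exact h
      · rw [hnx2 _ h]
        exact hlen _
  have hmono : StrictMono fun n => toLex (σ n) := by
    refine strictMono_nat_of_lt_succ fun n => ?_
    simp only [hσ, nx]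
    rw [Prod.Lex.toLex_lt_toLex]
    split_ifs with h
    · exact Or.inr ⟨rfl, Nat.lt_succ_self _⟩
    · exact Or.inl (Nat.lt_succ_self _)
  have hmono1 : ∀ m n, m ≤ n → (σ m).1 ≤ (σ n).1 := by
    intro m n h
    have := hmono.monotone h
    simp only [Prod.Lex.toLex_le_toLex] at this
    omega
  let R : ℕ → V := fun n => (p (σ n).1).getVert (σ n).2
  have hmem : ∀ n, R n ∈ (p (σ n).1).support := fun n => Walk.getVert_mem_support _ _
  have hne : ∀ m n, m < n → R m ≠ R n := by
    intro m n hmn heq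
    have h := hmono hmn
    simp only [Prod.Lex.toLex_lt_toLex] at h
    have hm := hσlt m
    have hn := hσlt n
    have hmm := hmem m
    have hnn := hmem n
    rcases h with h | ⟨h1, h2⟩
    · have h3 := hmeet _ _ h (R m) hmm (heq ▸ hnn)
      have h4 := (p (σ m).1).getVert_length
      rw [← h4] at h3
      have := (hp (σ m).1).getVert_injOn (x₁ := (σ m).2) (x₂ := (p (σ m).1).length)
        (by simp only [mem_ofPred_eq]; omega) (by simp) h3
      omega
    · simp only [R] at heq
      rw [← h1] at heq hn
      have := (hp (σ m).1).getVert_injOn (x₁ := (σ m).2) (x₂ := (σ n).2)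
        (by simp only [mem_ofPred_eq]; omega) (by simp only [mem_ofPred_eq]; omega) heq
      omega
  have hreach : ∀ k, ∃ n, σ n = (k, 0) := by
    intro k
    induction k with
    | zero => exact ⟨0, rfl⟩
    | succ k ih =>
      obtain ⟨n, hn⟩ := ih
      have : ∀ i, i < (p k).length → σ (n + i) = (k, i) := by
        intro i
        induction i with
        | zero => intro _; exact hn
        | succ i ih =>
          intro hi
          rw [← Nat.add_assoc, hσ, ih (by omega)]
          simp only [nx]
          rw [if_pos hi]
      refine ⟨n + ((p k).length - 1) + 1, ?_⟩
      have hk := hlen k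
      rw [hσ, this _ (by omega)]
      simp only [nx]
      rw [if_neg (by omega)]
  refine ⟨R, ⟨?_, ?_⟩, fun n => ⟨_, hmem n⟩, ?_⟩
  · intro m n hmn
    rcases lt_trichotomy m n with h | h | h
    · exact absurd hmn (hne _ _ h)
    · exact h
    · exact absurd hmn.symm (hne _ _ h)
  · intro n
    have h1 := (p (σ n).1).adj_getVert_succ (hσlt n)
    have h2 : R (n + 1) = (p (σ n).1).getVert ((σ n).2 + 1) := by
      simp only [R]
      rw [hσ]
      have := hσlt n
      by_cases h : (σ n).2 + 1 < (p (σ n).1).length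
      · rw [hnx1 _ h]
      · rw [hnx2 _ h]
        have h3 : (σ n).2 + 1 = (p (σ n).1).length := by omega
        rw [h3, Walk.getVert_length, Walk.getVert_zero]
    rw [h2]
    exact h1
  · intro k
    obtain ⟨n, hn⟩ := hreach k
    refine ⟨n, ?_, fun i => ⟨(σ (n + i)).1, ?_, hmem _⟩⟩
    · simp only [R]
      rw [hn]
      exact Walk.getVert_zero _
    · have := hmono1 n (n + i) (by omega)
      rw [hn] at this
      exact this

lemma backward (h : IsTopMinor hexGrid G) : HasThickEnd G := by
  classical
  obtain ⟨f, hf, P, hP, hPf, hPd⟩ := h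
  have hadjH : ∀ x y, hexGrid.Adj (x, y) (x + 1, y) := by
    intro x y
    rw [hexGrid, SimpleGraph.fromRel_adj]
    refine ⟨?_, Or.inl (Or.inl ⟨rfl, rfl⟩)⟩
    simp
  have hadjV : ∀ x y, x % 2 = y % 2 → hexGrid.Adj (x, y) (x, y + 1) := by
    intro x y h
    rw [hexGrid, SimpleGraph.fromRel_adj]
    refine ⟨?_, Or.inl (Or.inr ⟨rfl, rfl, h⟩)⟩
    simp
  have hray : ∀ y, ∃ R : ℕ → V, IsRay G R ∧ (∀ n, ∃ k, R n ∈ (P (hadjH k y)).support) ∧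
      ∀ k, ∃ n, R n = f (k, y) ∧ ∀ i, ∃ j ≥ k, R (n + i) ∈ (P (hadjH j y)).support := by
    intro y
    refine concat_ray (fun k => f (k, y)) (fun k => P (hadjH k y)) (fun k => hP _) ?_ ?_
    · intro a b hab
      simpa using hf hab
    · intro j k hjk x hx hx'
      have := hPd (hadjH j y) (hadjH k y) (by
        rw [Ne, Sym2.eq_iff]
        simp only [Prod.mk.injEq]
        omega) x hx hx'
      rcases this.1 with h | h
      · exfalso
        rcases this.2 with h' | h' <;>
        · have := hf (h.symm.trans h')
          simp only [Prod.mk.injEq] at this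
          omega
      · exact h
  choose R hR1 hR2 hR3 using hray
  refine ⟨R, hR1, ?_, ?_⟩
  · intro m n hmn
    rw [Set.disjoint_left]
    rintro _ ⟨i, rfl⟩ ⟨j, hj⟩
    obtain ⟨k, hk⟩ := hR2 m i
    obtain ⟨l, hl⟩ := hR2 n j
    rw [hj] at hl
    have := hPd (hadjH k m) (hadjH l n) (by
        rw [Ne, Sym2.eq_iff]
        simp only [Prod.mk.injEq]
        omega) _ hk hl
    rcases this.1 with h | h <;> rcases this.2 with h' | h' <;>
    · have := hf (h.symm.trans h')
      simp only [Prod.mk.injEq] at this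
      omega
  · intro y y' F
    obtain ⟨X, hX⟩ : ∃ X, ∀ z ∈ F, ∀ a b (h : hexGrid.Adj a b), X ≤ a.1 → X ≤ b.1 →
        z ∉ (P h).support := by
      induction F using Finset.induction_on with
      | empty => exact ⟨0, by simp⟩
      | insert z s _ ih =>
        obtain ⟨X, hX⟩ := ih
        by_cases hz : ∃ a b, ∃ h : hexGrid.Adj a b, z ∈ (P h).support
        · obtain ⟨a, b, h, hz⟩ := hz
          refine ⟨max X (max a.1 b.1 + 1), ?_⟩
          intro w hw a' b' h' ha' hb'
          rcases Finset.mem_insert.mp hw with rfl | hw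
          · intro hw'
            have := hPd h h' (by
              rw [Ne, Sym2.eq_iff]
              rintro (⟨rfl, rfl⟩ | ⟨rfl, rfl⟩) <;> omega) w hz hw'
            rcases this.1 with h1 | h1 <;> rcases this.2 with h2 | h2 <;>
            · have := hf (h1.symm.trans h2)
              subst this
              omega
          · exact hX w hw a' b' h' (by omega) (by omega)
        · push Not at hz
          refine ⟨X, ?_⟩
          intro w hw a' b' h' ha' hb'
          rcases Finset.mem_insert.mp hw with rfl | hw
          · exact hz a' b' h'
          · exact hX w hw a' b' h' ha' hb'
    let Reach : ℕ × ℕ → ℕ × ℕ → Prop := fun a b =>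
      ∃ p : G.Walk (f a) (f b), ∀ x ∈ p.support, x ∉ F
    have hsymm : ∀ a b, Reach a b → Reach b a := by
      rintro a b ⟨p, hp⟩
      exact ⟨p.reverse, by simpa using hp⟩
    have htrans : ∀ a b c, Reach a b → Reach b c → Reach a c := by
      rintro a b c ⟨p, hp⟩ ⟨q, hq⟩
      refine ⟨p.append q, fun x hx => ?_⟩
      rcases (Walk.mem_support_append_iff _ _).mp hx with hx | hx
      · exact hp x hx
      · exact hq x hx
    have hadj : ∀ a b, hexGrid.Adj a b → X ≤ a.1 → X ≤ b.1 → Reach a b :=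
      fun a b h ha hb => ⟨P h, fun x hx hxF => hX x hxF a b h ha hb hx⟩
    have hup : ∀ y, Reach (X, y) (X, y + 1) := by
      intro y
      by_cases h : X % 2 = y % 2
      · exact hadj _ _ (hadjV X y h) le_rfl le_rfl
      · have h1 := hadj _ _ (hadjH X y) le_rfl (Nat.le_succ X)
        have h2 := hadj _ _ (hadjV (X + 1) y (by omega)) (Nat.le_succ X) (Nat.le_succ X)
        have h3 := hadj _ _ (hadjH X (y + 1)) le_rfl (Nat.le_succ X)
        exact htrans _ _ _ h1 (htrans _ _ _ h2 (hsymm _ _ h3))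
    have h0 : ∀ y, Reach (X, 0) (X, y) := by
      intro y
      induction y with
      | zero =>
        have := hup 0
        exact htrans _ _ _ this (hsymm _ _ this)
      | succ y ih => exact htrans _ _ _ ih (hup y)
    obtain ⟨p, hp⟩ := htrans _ _ _ (hsymm _ _ (h0 y)) (h0 y')
    obtain ⟨m, hm, hm'⟩ := hR3 y X
    obtain ⟨n, hn, hn'⟩ := hR3 y' X
    refine ⟨m, n, ?_, ?_, ?_⟩
    · intro i hi
      obtain ⟨j, hj, hj'⟩ := hm' i
      exact hX _ hi _ _ (hadjH j y) hj (Nat.le_succ_of_le hj) hj'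
    · intro i hi
      obtain ⟨j, hj, hj'⟩ := hn' i
      exact hX _ hi _ _ (hadjH j y') hj (Nat.le_succ_of_le hj) hj'
    · rw [hm, hn]
      exact ⟨p, hp⟩

end Halin

/-- Halin's grid theorem: an infinite graph has a thick end iff it contains a
subdivision of the hexagonal quarter grid. -/
theorem halin_grid_theorem {V : Type u} (G : SimpleGraph V) [Infinite V] :
    HasThickEnd G ↔ IsTopMinor hexGrid G := by
  exact ⟨Halin.forward, Halin.backward⟩
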